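/- Let L = {R_n : n ∈ ℕ} consist of countably many binary relation symbols, and let μ_K be the law of the random structure on ℕ in which R_n(i, i) never holds, each R_n is symmetric, and the events 'R_n(i, j) holds' for n ∈ ℕ and unordered pairs {i, j} of distinct naturals are mutually independent, each with probability 1/2. Then μ_K is an invariant, ergodic Borel probability measure on Str_L, and μ_K is properly ergodic: every isomorphism class {N ∈ Str_L : N ≅ M} is μ_K-null. -/

import Mathlib

open FirstOrder Language MeasureTheory Set
open scoped ENNReal

namespace Ergo


/-- The space of L-structures with domain ℕ. -/
abbrev StrL (L : FirstOrder.Language.{0,0}) : Type :=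
  ∀ n : ℕ, L.Relations n → (Fin n → ℕ) → Bool

variable (L : FirstOrder.Language.{0,0})

/-- The L-structure on ℕ coded by a point of `StrL L`. -/
def toStructure [L.IsRelational] (x : StrL L) : L.Structure ℕ where
  funMap := fun f _ => isEmptyElim f
  RelMap := fun {n} r a => x n r a = true

/-- The logic action of a permutation of ℕ on `StrL L`. -/
def act (σ : Equiv.Perm ℕ) (x : StrL L) : StrL L :=
  fun n r a => x n r (fun i => σ.symm (a i))

/-- Satisfaction of a sentence at a point of `StrL L`. -/
def SatS [L.IsRelational] (x : StrL L) (φ : L.Sentence) : Prop :=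
  letI := toStructure L x
  Sentence.Realize ℕ φ

/-- Satisfaction of a formula at a point of `StrL L` under an assignment. -/
def SatF [L.IsRelational] (x : StrL L) {n : ℕ} (φ : L.Formula (Fin n)) (a : Fin n → ℕ) : Prop :=
  letI := toStructure L x
  Formula.Realize φ a

/-- `⟦φ⟧`, the set of structures satisfying the sentence φ. -/
def extS [L.IsRelational] (φ : L.Sentence) : Set (StrL L) := {x | SatS L x φ}

/-- `⟦φ(ā)⟧`, the set of structures satisfying φ(ā). -/
def extF [L.IsRelational] {n : ℕ} (φ : L.Formula (Fin n)) (a : Fin n → ℕ) : Set (StrL L) :=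
  {x | SatF L x φ a}

/-- Invariance of a measure under the logic action. -/
def Invariant (μ : Measure (StrL L)) : Prop :=
  ∀ (σ : Equiv.Perm ℕ) (X : Set (StrL L)), MeasurableSet X → μ (act L σ '' X) = μ X

/-- An ergodic structure: an ergodic invariant Borel probability measure on `StrL L`. -/
def IsErgodicStructure (μ : Measure (StrL L)) : Prop :=
  IsProbabilityMeasure μ ∧ Invariant L μ ∧
    ∀ X : Set (StrL L), MeasurableSet X →
      (∀ σ : Equiv.Perm ℕ, μ (symmDiff X (act L σ '' X)) = 0) → μ X = 0 ∨ μ X = 1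

/-- The isomorphism class (orbit of the logic action) of a point of `StrL L`. -/
def IsoClass (M : StrL L) : Set (StrL L) := {N | ∃ σ : Equiv.Perm ℕ, act L σ M = N}

/-- All isomorphism classes are null: the defining property of proper ergodicity. -/
def OrbitsNull (μ : Measure (StrL L)) : Prop := ∀ M : StrL L, μ (IsoClass L M) = 0

/-- Realization of a formula in an explicitly given structure. -/
def RealizeIn (M : Type) (iM : L.Structure M) {n : ℕ} (φ : L.Formula (Fin n))
    (a : Fin n → M) : Prop :=
  letI := iM
  Formula.Realize φ a

/-- Satisfaction of a sentence in an explicitly given structure. -/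
def SatSIn (M : Type) (iM : L.Structure M) (φ : L.Sentence) : Prop :=
  letI := iM
  Sentence.Realize M φ

/-- A complete first-order n-type: the set of formulas satisfied by a fixed tuple
in some L-structure. -/
def IsCompleteType (n : ℕ) (p : Set (L.Formula (Fin n))) : Prop :=
  ∃ (M : Type) (iM : L.Structure M) (a : Fin n → M), p = {φ | RealizeIn L M iM φ a}

/-- A complete quantifier-free n-type. -/
def IsQfCompleteType (n : ℕ) (p : Set (L.Formula (Fin n))) : Prop :=
  ∃ (M : Type) (iM : L.Structure M) (a : Fin n → M),
    p = {φ | φ.IsQF ∧ RealizeIn L M iM φ a}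

/-- A type is non-redundant if it contains `xᵢ ≠ xⱼ` for all `i ≠ j`. -/
def NonRedundant (n : ℕ) (p : Set (L.Formula (Fin n))) : Prop :=
  ∀ i j : Fin n, i ≠ j → BoundedFormula.not (Term.equal (Term.var i) (Term.var j)) ∈ p

/-- The set of structures in which the canonical distinct tuple (0,…,n−1) realizes p;
`μ` of this set is the measure `μ(p)` of the type `p`. -/
def typeSet [L.IsRelational] {n : ℕ} (p : Set (L.Formula (Fin n))) : Set (StrL L) :=
  {x | ∀ φ ∈ p, SatF L x φ (fun i => (i : ℕ))}

/-- Realization of (all formulas of) a type in an explicit structure by a tuple. -/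
def RealizesTypeIn (M : Type) (iM : L.Structure M) {n : ℕ} (p : Set (L.Formula (Fin n)))
    (a : Fin n → M) : Prop :=
  ∀ φ ∈ p, RealizeIn L M iM φ a

/-- χ-rootedness with respect to quantifier-free types. -/
def ChiRootedQfOn (M : Type) (iM : L.Structure M) {n : ℕ} (χ : L.Formula (Fin n)) : Prop :=
  ∀ p : Set (L.Formula (Fin n)), IsQfCompleteType L n p → NonRedundant L n p → χ ∈ p →
    (∃ a, RealizesTypeIn L M iM p a) →
    ∃ r : M, ∀ a, RealizesTypeIn L M iM p a → ∃ i, a i = r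

/-- χ-rootedness with respect to complete first-order types. -/
def ChiRootedFullOn (M : Type) (iM : L.Structure M) {n : ℕ} (χ : L.Formula (Fin n)) : Prop :=
  ∀ p : Set (L.Formula (Fin n)), IsCompleteType L n p → NonRedundant L n p → χ ∈ p →
    (∃ a, RealizesTypeIn L M iM p a) →
    ∃ r : M, ∀ a, RealizesTypeIn L M iM p a → ∃ i, a i = r

/-- The relations of the kaleidoscope language: countably many binary relation symbols. -/
def kalRel : ℕ → Type
  | 2 => ℕ
  | _ => Empty

/-- The kaleidoscope language `L = {Rₙ : n ∈ ℕ}`, all binary. -/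
def kalLang : FirstOrder.Language.{0,0} := ⟨fun _ => Empty, kalRel⟩

section BernoulliShift

open Filter Topology

/-- If finite measures dominated by a fixed finite measure converge on a generating π-system and on
the whole space, they converge on every measurable set. -/
theorem tendsto_measureReal_of_isPiSystem {Ω : Type*} [m0 : MeasurableSpace Ω]
    {ν m : Measure Ω} [IsFiniteMeasure ν] {ms : ℕ → Measure Ω} (hms : ∀ n, ms n ≤ ν) (hm : m ≤ ν)
    {C : Set (Set Ω)} (hgen : m0 = MeasurableSpace.generateFrom C) (hpi : IsPiSystem C)
    (hC : ∀ s ∈ C, Tendsto (fun n => (ms n).real s) atTop (𝓝 (m.real s)))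
    (huniv : Tendsto (fun n => (ms n).real univ) atTop (𝓝 (m.real univ)))
    {s : Set Ω} (hs : MeasurableSet s) :
    Tendsto (fun n => (ms n).real s) atTop (𝓝 (m.real s)) := by
  have hfin : ∀ n, IsFiniteMeasure (ms n) := fun n => isFiniteMeasure_of_le ν (hms n)
  have hfin' : IsFiniteMeasure m := isFiniteMeasure_of_le ν hm
  refine MeasurableSpace.induction_on_inter (C := fun s _ =>
    Tendsto (fun n => (ms n).real s) atTop (𝓝 (m.real s))) hgen hpi (by simp) hC
    (fun t ht h => ?_) (fun f hd hf h => ?_) s hs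
  · simp only [measureReal_compl ht]
    exact huniv.sub h
  · have key : ∀ (κ : Measure Ω) [IsFiniteMeasure κ],
        HasSum (fun i => κ.real (f i)) (κ.real (⋃ i, f i)) := by
      intro κ _
      have h1 : ∑' i, κ (f i) ≠ ∞ := by
        rw [← measure_iUnion hd hf]; exact measure_ne_top _ _
      rw [measureReal_def, measure_iUnion hd hf, ENNReal.tsum_toReal_eq fun i => measure_ne_top _ _]
      exact ENNReal.hasSum_toReal h1
    simp only [← (key _).tsum_eq]
    refine tendsto_tsum_of_dominated_convergence (key ν).summable h
      (Eventually.of_forall fun n i => ?_)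
    rw [Real.norm_of_nonneg measureReal_nonneg]
    exact ENNReal.toReal_mono (measure_ne_top _ _) (hms n (f i))

variable {ι : Type*}

/-- The cylinder of Boolean sequences agreeing with `ε` on `F`. -/
def boolCylinder (F : Finset ι) (ε : ι → Bool) : Set (ι → Bool) := {y | ∀ t ∈ F, y t = ε t}

/-- The family of all cylinders. -/
def boolCylinders (ι : Type*) : Set (Set (ι → Bool)) :=
  {s | ∃ (F : Finset ι) (ε : ι → Bool), s = boolCylinder F ε}

theorem measurableSet_boolCylinder (F : Finset ι) (ε : ι → Bool) :
    MeasurableSet (boolCylinder F ε) := by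
  have : boolCylinder F ε = ⋂ t ∈ F, (fun y : ι → Bool => y t) ⁻¹' {ε t} := by
    ext y; simp [boolCylinder]
  rw [this]
  exact F.measurableSet_biInter fun t _ => measurable_pi_apply t (MeasurableSet.singleton _)

open Classical in
theorem boolCylinder_inter_of_mem {F G : Finset ι} {ε δ y : ι → Bool}
    (hF : y ∈ boolCylinder F ε) (hG : y ∈ boolCylinder G δ) :
    boolCylinder F ε ∩ boolCylinder G δ = boolCylinder (F ∪ G) y := by
  ext z
  simp only [boolCylinder, mem_inter_iff, mem_ofPred_eq, Finset.mem_union] at *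
  constructor
  · rintro ⟨h1, h2⟩ t (ht | ht)
    · rw [h1 t ht, hF t ht]
    · rw [h2 t ht, hG t ht]
  · intro h
    exact ⟨fun t ht => by rw [h t (.inl ht), hF t ht], fun t ht => by rw [h t (.inr ht), hG t ht]⟩

theorem isPiSystem_boolCylinders : IsPiSystem (boolCylinders ι) := by
  classical
  rintro _ ⟨F, ε, rfl⟩ _ ⟨G, δ, rfl⟩ ⟨y, hF, hG⟩
  exact ⟨F ∪ G, y, boolCylinder_inter_of_mem hF hG⟩

theorem generateFrom_boolCylinders :
    (MeasurableSpace.pi : MeasurableSpace (ι → Bool)) =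
      MeasurableSpace.generateFrom (boolCylinders ι) := by
  refine le_antisymm (iSup_le fun t => ?_) (MeasurableSpace.generateFrom_le ?_)
  · rw [← measurable_iff_comap_le]
    refine @measurable_to_bool _ (MeasurableSpace.generateFrom _) _
      (MeasurableSpace.measurableSet_generateFrom ⟨{t}, fun _ => true, ?_⟩)
    ext y
    simp [boolCylinder]
  · rintro _ ⟨F, ε, rfl⟩
    exact measurableSet_boolCylinder F ε

theorem preimage_comp_boolCylinder (π : Equiv.Perm ι) (F : Finset ι) (ε : ι → Bool) :
    (fun y : ι → Bool => y ∘ π) ⁻¹' boolCylinder F ε =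
      boolCylinder (F.map π.toEmbedding) (ε ∘ π.symm) := by
  ext y
  simp only [boolCylinder, mem_preimage, mem_ofPred_eq, Finset.forall_mem_map]
  simp

theorem measurable_comp_perm (π : Equiv.Perm ι) : Measurable fun y : ι → Bool => y ∘ π :=
  measurable_pi_lambda _ fun t => measurable_pi_apply (π t)

/-- The fair-coin measure on `ι → Bool`, characterised by the measures of cylinders. -/
def IsFairCoin (ν : Measure (ι → Bool)) : Prop :=
  ∀ (F : Finset ι) (ε : ι → Bool), ν (boolCylinder F ε) = (1 / 2 : ℝ≥0∞) ^ F.card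

variable {ν : Measure (ι → Bool)}

theorem IsFairCoin.isProbabilityMeasure (hν : IsFairCoin ν) : IsProbabilityMeasure ν :=
  ⟨by simpa [boolCylinder] using hν ∅ fun _ => false⟩

theorem IsFairCoin.measurePreserving (hν : IsFairCoin ν) (π : Equiv.Perm ι) :
    MeasurePreserving (fun y : ι → Bool => y ∘ π) ν ν := by
  have := hν.isProbabilityMeasure
  refine ⟨measurable_comp_perm π, ?_⟩
  have := Measure.isProbabilityMeasure_map (μ := ν) (measurable_comp_perm π).aemeasurable
  refine ext_of_generate_finite _ generateFrom_boolCylinders isPiSystem_boolCylinders ?_ (by simp)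
  rintro _ ⟨F, ε, rfl⟩
  rw [Measure.map_apply (measurable_comp_perm π) (measurableSet_boolCylinder F ε),
    preimage_comp_boolCylinder, hν, hν, Finset.card_map]

open Classical in
theorem IsFairCoin.inter_of_disjoint (hν : IsFairCoin ν) {F G : Finset ι} (h : Disjoint F G)
    (ε δ : ι → Bool) :
    ν (boolCylinder F ε ∩ boolCylinder G δ) = ν (boolCylinder F ε) * ν (boolCylinder G δ) := by
  let y : ι → Bool := fun t => if t ∈ F then ε t else δ t
  have hF : y ∈ boolCylinder F ε := fun t ht => if_pos ht
  have hG : y ∈ boolCylinder G δ := fun t ht => if_neg (Finset.disjoint_right.1 h ht)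
  rw [boolCylinder_inter_of_mem hF hG, hν, hν, hν, Finset.card_union_of_disjoint h, pow_add]

/-- Permutations eventually displacing finite sets from one another act in a mixing way on
the fair-coin measure. -/
theorem IsFairCoin.tendsto_inter (hν : IsFairCoin ν) (π : ℕ → Equiv.Perm ι)
    (hπ : ∀ F G : Finset ι, ∀ᶠ n in atTop, Disjoint F (G.map (π n).toEmbedding))
    {A B : Set (ι → Bool)} (hA : MeasurableSet A) (hB : MeasurableSet B) :
    Tendsto (fun n => ν.real (A ∩ (fun y : ι → Bool => y ∘ π n) ⁻¹' B)) atTop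
      (𝓝 (ν.real A * ν.real B)) := by
  have hprob := hν.isProbabilityMeasure
  have hsmul : ∀ s, ν s • ν ≤ ν := fun s t => by
    simpa using mul_le_mul_left (prob_le_one (μ := ν) (s := s)) (ν t)
  have hT := fun n => measurable_comp_perm (π n)
  have hcyl : ∀ (F : Finset ι) (ε : ι → Bool) {B : Set (ι → Bool)}, MeasurableSet B →
      Tendsto (fun n => ν.real (boolCylinder F ε ∩ (fun y : ι → Bool => y ∘ π n) ⁻¹' B)) atTop
        (𝓝 (ν.real (boolCylinder F ε) * ν.real B)) := by
    intro F ε B hB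
    let ms : ℕ → Measure (ι → Bool) := fun n =>
      (ν.restrict (boolCylinder F ε)).map (fun y : ι → Bool => y ∘ π n)
    have happ : ∀ n {s : Set (ι → Bool)}, MeasurableSet s →
        (ms n).real s = ν.real (boolCylinder F ε ∩ (fun y : ι → Bool => y ∘ π n) ⁻¹' s) := by
      intro n s hs
      rw [measureReal_def, Measure.map_apply (hT n) hs, Measure.restrict_apply (hT n hs),
        inter_comm, measureReal_def]
    have := tendsto_measureReal_of_isPiSystem (ν := ν) (m := ν (boolCylinder F ε) • ν) (ms := ms)
      (fun n => (Measure.map_mono Measure.restrict_le_self (hT n)).trans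
        (hν.measurePreserving (π n)).map_eq.le) (hsmul _)
      generateFrom_boolCylinders isPiSystem_boolCylinders ?_ ?_ hB
    · simpa [happ _ hB, measureReal_def] using this
    · rintro _ ⟨G, δ, rfl⟩
      refine tendsto_const_nhds.congr' ?_
      filter_upwards [hπ F G] with n hn
      rw [happ _ (measurableSet_boolCylinder G δ), preimage_comp_boolCylinder, measureReal_def,
        measureReal_def, hν.inter_of_disjoint hn, ← preimage_comp_boolCylinder,
        (hν.measurePreserving (π n)).measure_preimage
          (measurableSet_boolCylinder G δ).nullMeasurableSet]
      simp
    · simp [happ _ MeasurableSet.univ, measureReal_def]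
  let ms : ℕ → Measure (ι → Bool) := fun n => ν.restrict ((fun y : ι → Bool => y ∘ π n) ⁻¹' B)
  have happ : ∀ n {s : Set (ι → Bool)}, MeasurableSet s →
      (ms n).real s = ν.real (s ∩ (fun y : ι → Bool => y ∘ π n) ⁻¹' B) := by
    intro n s hs
    rw [measureReal_def, Measure.restrict_apply hs, measureReal_def]
  have := tendsto_measureReal_of_isPiSystem (ν := ν) (m := ν B • ν) (ms := ms)
    (fun n => Measure.restrict_le_self) (hsmul _)
    generateFrom_boolCylinders isPiSystem_boolCylinders ?_ ?_ hA
  · simpa [happ _ hA, measureReal_def, mul_comm] using this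
  · rintro _ ⟨F, ε, rfl⟩
    simpa [happ _ (measurableSet_boolCylinder F ε), measureReal_def, mul_comm] using hcyl F ε hB
  · simp [happ _ MeasurableSet.univ, measureReal_def,
      (hν.measurePreserving (π _)).measure_preimage hB.nullMeasurableSet]

end BernoulliShift

section Kaleidoscope

open Filter Topology

/-- A relation symbol together with an unordered pair of distinct vertices. -/
abbrev KalEdge : Type := ℕ × {e : Sym2 ℕ // ¬ e.IsDiag}

/-- The permutation of coloured edges induced by a permutation of the vertices. -/
def edgePerm (σ : Equiv.Perm ℕ) : Equiv.Perm KalEdge :=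
  Equiv.prodCongr (Equiv.refl ℕ)
    (Equiv.subtypeEquiv ⟨Sym2.map σ, Sym2.map σ.symm, fun e => by simp [Sym2.map_map],
      fun e => by simp [Sym2.map_map]⟩ fun e => (not_congr (Sym2.isDiag_map σ.injective)).symm)

/-- The symmetric irreflexive structure with prescribed edges. -/
def ofEdges (y : KalEdge → Bool) : StrL kalLang
  | 2, r, a => if h : a 0 = a 1 then false else
      y ((r : ℕ), ⟨s(a 0, a 1), by simpa using h⟩)
  | 0, _, _ => false
  | 1, _, _ => false
  | _ + 3, _, _ => false

/-- The edges of a structure, each read off in increasing order of its endpoints. -/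
def edges (x : StrL kalLang) (t : KalEdge) : Bool :=
  x 2 t.1 ![t.2.1.inf, t.2.1.sup]

theorem strL_kalLang_ext {x y : StrL kalLang}
    (h : ∀ n i j : ℕ, x 2 n ![i, j] = y 2 n ![i, j]) : x = y := by
  funext k r a
  match k, r, a with
  | 2, r, a =>
    have ha : a = ![a 0, a 1] := by
      funext i; fin_cases i <;> rfl
    rw [ha]; exact h r _ _
  | 0, r, _ => exact Empty.elim r
  | 1, r, _ => exact Empty.elim r
  | _ + 3, r, _ => exact Empty.elim r

theorem ofEdges_two (y : KalEdge → Bool) (n i j : ℕ) :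
    ofEdges y 2 n ![i, j] = if h : i = j then false else y (n, ⟨s(i, j), by simpa using h⟩) :=
  rfl

theorem ofEdges_edges {x : StrL kalLang} (hs : ∀ n i j : ℕ, x 2 n ![i, j] = x 2 n ![j, i])
    (hi : ∀ n i : ℕ, x 2 n ![i, i] = false) : ofEdges (edges x) = x := by
  refine strL_kalLang_ext fun n i j => ?_
  rw [ofEdges_two]
  split_ifs with h
  · rw [h, hi]
  · rcases le_total i j with hij | hij
    · simp [edges, hij]
    · simp [edges, hij, hs n i j]

theorem act_ofEdges (σ : Equiv.Perm ℕ) (y : KalEdge → Bool) :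
    act kalLang σ (ofEdges y) = ofEdges (y ∘ edgePerm σ.symm) := by
  refine strL_kalLang_ext fun n i j => ?_
  have h1 : act kalLang σ (ofEdges y) 2 n ![i, j] =
      ofEdges y 2 n ![σ.symm i, σ.symm j] := by
    unfold act
    congr 1
    funext k; fin_cases k <;> rfl
  rw [h1, ofEdges_two, ofEdges_two]
  by_cases h : i = j
  · simp [h]
  · rw [dif_neg h, dif_neg (by simpa using h)]
    rfl

theorem measurable_eval (n i j : ℕ) :
    Measurable fun x : StrL kalLang => x 2 n ![i, j] :=
  (measurable_pi_apply (X := fun _ : Fin 2 → ℕ => Bool) ![i, j]).comp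
    ((measurable_pi_apply (X := fun _ : kalLang.Relations 2 => (Fin 2 → ℕ) → Bool) n).comp
      (measurable_pi_apply 2))

theorem measurable_edges : Measurable edges :=
  measurable_pi_lambda _ fun t => measurable_eval t.1 _ _

theorem measurable_ofEdges : Measurable ofEdges := by
  refine measurable_pi_lambda _ fun k => measurable_pi_lambda _ fun r =>
    measurable_pi_lambda _ fun a => ?_
  match k, r, a with
  | 2, r, a =>
    by_cases h : a 0 = a 1
    · simp [ofEdges, h]
    · simp only [ofEdges, h, dite_false]
      exact measurable_pi_apply _
  | 0, r, _ => exact Empty.elim r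
  | 1, r, _ => exact Empty.elim r
  | _ + 3, r, _ => exact Empty.elim r

theorem measurable_act (L : FirstOrder.Language.{0,0}) (σ : Equiv.Perm ℕ) :
    Measurable (act L σ) :=
  measurable_pi_lambda _ fun n => measurable_pi_lambda _ fun r => measurable_pi_lambda _ fun _ =>
    (measurable_pi_apply (X := fun _ : Fin n → ℕ => Bool) _).comp
      ((measurable_pi_apply r).comp (measurable_pi_apply n))

theorem image_act_eq_preimage (L : FirstOrder.Language.{0,0}) (σ : Equiv.Perm ℕ)
    (X : Set (StrL L)) : act L σ '' X = act L σ.symm ⁻¹' X := by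
  exact congrFun (image_eq_preimage_of_inverse (f := act L σ) (g := act L σ.symm)
    (fun x => by unfold act; simp) (fun x => by unfold act; simp)) X

/-- The involution of `ℕ` exchanging `[0, n)` with `[n, 2n)`. -/
def blockSwap (n : ℕ) : Equiv.Perm ℕ :=
  Function.Involutive.toPerm
    (fun i => if i < n then i + n else if i < 2 * n then i - n else i) (by
      intro i
      dsimp only
      split_ifs <;> omega)

theorem le_blockSwap {n i : ℕ} (h : i < n) : n ≤ blockSwap n i := by
  have : blockSwap n i = i + n := if_pos h
  omega

theorem le_sup_of_mem_sym2 {e : Sym2 ℕ} {i : ℕ} (h : i ∈ e) : i ≤ e.sup := by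
  induction e with | _ a b
  rcases Sym2.mem_iff.1 h with rfl | rfl <;> simp

theorem eventually_disjoint_edgePerm_blockSwap (F G : Finset KalEdge) :
    ∀ᶠ n in atTop, Disjoint F (G.map (edgePerm (blockSwap n)).toEmbedding) := by
  have hlt : ∀ F : Finset KalEdge, ∀ᶠ n in atTop, ∀ t ∈ F, ∀ i ∈ t.2.1, i < n := by
    intro F
    rw [Filter.eventually_all_finset]
    intro t _
    filter_upwards [eventually_gt_atTop t.2.1.sup] with n hn i hi
    exact (le_sup_of_mem_sym2 hi).trans_lt hn
  filter_upwards [hlt F, hlt G] with n hF hG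
  rw [Finset.disjoint_right]
  intro t ht htF
  obtain ⟨u, hu, rfl⟩ := Finset.mem_map.1 ht
  obtain ⟨m, ⟨e, he⟩⟩ := u
  induction e with | _ i j
  have h1 := le_blockSwap (hG _ hu i (by simp))
  have h2 := hF _ htF (blockSwap n i) (Sym2.mem_mk_left _ _)
  omega

/-- The law of the coloured edges under a measure with independent fair edges. -/
theorem isFairCoin_map_edges {μ : Measure (StrL kalLang)}
    (hiid : ∀ F : Finset (ℕ × ℕ × ℕ), (∀ t ∈ F, t.2.1 < t.2.2) →
      ∀ ε : ℕ × ℕ × ℕ → Bool,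
        μ {x : StrL kalLang | ∀ t ∈ F, x 2 t.1 ![t.2.1, t.2.2] = ε t} =
          (1 / 2 : ℝ≥0∞) ^ F.card) :
    IsFairCoin (μ.map edges) := by
  intro F ε
  let f : KalEdge ↪ ℕ × ℕ × ℕ := ⟨fun t => (t.1, t.2.1.inf, t.2.1.sup), by
    rintro ⟨m, e, he⟩ ⟨n, d, hd⟩ h
    simp only [Prod.mk.injEq] at h
    obtain ⟨rfl, h⟩ := h
    obtain rfl := Sym2.inf_eq_inf_and_sup_eq_sup.1 h
    rfl⟩
  have h := hiid (F.map f) ?_ (Function.extend f ε fun _ => false)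
  · rw [Finset.card_map] at h
    rw [Measure.map_apply measurable_edges (measurableSet_boolCylinder F ε), ← h]
    congr 1
    ext x
    simp only [boolCylinder, mem_preimage, mem_ofPred_eq, Finset.forall_mem_map,
      f.injective.extend_apply]
    rfl
  · intro t ht
    obtain ⟨⟨m, ⟨e, he⟩⟩, -, rfl⟩ := Finset.mem_map.1 ht
    induction e with | _ i j
    have hij : i ≠ j := by simpa using he
    exact inf_lt_sup.2 hij

theorem map_ofEdges_map_edges {μ : Measure (StrL kalLang)} [IsProbabilityMeasure μ]
    (hsym : μ {x : StrL kalLang | ∀ n i j : ℕ, x 2 n ![i, j] = x 2 n ![j, i]} = 1)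
    (hirr : μ {x : StrL kalLang | ∀ n i : ℕ, x 2 n ![i, i] = false} = 1) :
    (μ.map edges).map ofEdges = μ := by
  have hs : ∀ᵐ x ∂μ, ∀ n i j : ℕ, x 2 n ![i, j] = x 2 n ![j, i] := by
    rw [← prob_compl_eq_zero_iff] at hsym
    · exact hsym
    · simp only [ofPred_forall]
      exact .iInter fun n => .iInter fun i => .iInter fun j =>
        measurableSet_eq_fun (measurable_eval n i j) (measurable_eval n j i)
  have hi : ∀ᵐ x ∂μ, ∀ n i : ℕ, x 2 n ![i, i] = false := by
    rw [← prob_compl_eq_zero_iff] at hirr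
    · exact hirr
    · simp only [ofPred_forall]
      exact .iInter fun n => .iInter fun i => measurable_eval n i i (MeasurableSet.singleton false)
  rw [Measure.map_map measurable_ofEdges measurable_edges]
  conv_rhs => rw [← Measure.map_id (μ := μ)]
  refine Measure.map_congr ?_
  filter_upwards [hs, hi] with x h1 h2
  exact ofEdges_edges h1 h2

theorem orbitsNull_of_iid {μ : Measure (StrL kalLang)}
    (hiid : ∀ F : Finset (ℕ × ℕ × ℕ), (∀ t ∈ F, t.2.1 < t.2.2) →
      ∀ ε : ℕ × ℕ × ℕ → Bool,
        μ {x : StrL kalLang | ∀ t ∈ F, x 2 t.1 ![t.2.1, t.2.2] = ε t} =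
          (1 / 2 : ℝ≥0∞) ^ F.card) :
    OrbitsNull kalLang μ := by
  intro M
  have hnull : ∀ a b : ℕ,
      μ {N : StrL kalLang | ∀ n : ℕ, N 2 n ![0, 1] = M 2 n ![a, b]} = 0 := by
    intro a b
    refine le_antisymm (ge_of_tendsto' (ENNReal.tendsto_pow_atTop_nhds_zero_of_lt_one
      (r := 1 / 2) (by simp)) fun k => ?_) zero_le
    let f : ℕ ↪ ℕ × ℕ × ℕ := ⟨fun n => (n, 0, 1), fun m n h => by simpa using h⟩
    have h := hiid ((Finset.range k).map f)
      (Finset.forall_mem_map.2 fun _ _ => zero_lt_one) fun t => M 2 t.1 ![a, b]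
    rw [Finset.card_map, Finset.card_range] at h
    rw [← h]
    refine measure_mono fun N hN => ?_
    simp only [mem_ofPred_eq, Finset.forall_mem_map]
    exact fun n _ => hN n
  refine measure_mono_null ?_ (measure_iUnion_null fun a => measure_iUnion_null fun b => hnull a b)
  rintro _ ⟨σ, rfl⟩
  simp only [mem_iUnion, mem_ofPred_eq]
  refine ⟨σ.symm 0, σ.symm 1, fun n => ?_⟩
  unfold act
  congr 1
  funext k; fin_cases k <;> rfl

end Kaleidoscope

/-- The kaleidoscope random graph: the law μ_K in which each Rₙ is irreflexive and symmetric
and the events `Rₙ(i,j)` for n ∈ ℕ and unordered pairs {i,j} of distinct naturals are i.i.d.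
Bernoulli(1/2), is an invariant ergodic probability measure, and it is properly ergodic:
every isomorphism class is μ_K-null. -/
theorem statement16 (μK : Measure (StrL kalLang))
    (hiid : ∀ F : Finset (ℕ × ℕ × ℕ), (∀ t ∈ F, t.2.1 < t.2.2) →
      ∀ ε : ℕ × ℕ × ℕ → Bool,
        μK {x : StrL kalLang | ∀ t ∈ F, x 2 t.1 ![t.2.1, t.2.2] = ε t} =
          (1 / 2 : ℝ≥0∞) ^ F.card)
    (hsym : μK {x : StrL kalLang | ∀ n i j : ℕ, x 2 n ![i, j] = x 2 n ![j, i]} = 1)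
    (hirr : μK {x : StrL kalLang | ∀ n i : ℕ, x 2 n ![i, i] = false} = 1) :
    IsErgodicStructure kalLang μK ∧ OrbitsNull kalLang μK := by
  have hν := isFairCoin_map_edges hiid
  have hprob : IsProbabilityMeasure μK := ⟨by simpa using hiid ∅ (by simp) fun _ => false⟩
  have hmap := map_ofEdges_map_edges hsym hirr
  set ν := μK.map edges
  have hμ : ∀ {X : Set (StrL kalLang)}, MeasurableSet X → μK X = ν (ofEdges ⁻¹' X) := by
    intro X hX
    rw [← Measure.map_apply measurable_ofEdges hX, hmap]
  have hpre : ∀ (σ : Equiv.Perm ℕ) (X : Set (StrL kalLang)),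
      ofEdges ⁻¹' (act kalLang σ '' X) = (fun y => y ∘ edgePerm σ) ⁻¹' (ofEdges ⁻¹' X) := by
    intro σ X
    ext y
    simp [image_act_eq_preimage, act_ofEdges]
  have himg : ∀ (σ : Equiv.Perm ℕ) {X : Set (StrL kalLang)}, MeasurableSet X →
      MeasurableSet (act kalLang σ '' X) := by
    intro σ X hX
    rw [image_act_eq_preimage]
    exact measurable_act _ _ hX
  refine ⟨⟨hprob, fun σ X hX => ?_, fun X hX hinv => ?_⟩, orbitsNull_of_iid hiid⟩
  · rw [hμ (himg σ hX), hpre, hμ hX, (hν.measurePreserving _).measure_preimage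
      (measurable_ofEdges hX).nullMeasurableSet]
  · have hlim := hν.tendsto_inter (fun n => edgePerm (blockSwap n))
      eventually_disjoint_edgePerm_blockSwap (measurable_ofEdges hX) (measurable_ofEdges hX)
    have hconst : ∀ n, ν.real (ofEdges ⁻¹' X ∩
        (fun y => y ∘ edgePerm (blockSwap n)) ⁻¹' (ofEdges ⁻¹' X)) = μK.real X := by
      intro n
      rw [← hpre, ← preimage_inter, measureReal_def, ← hμ (hX.inter (himg _ hX)), measureReal_def]
      congr 1
      have hae := measure_symmDiff_eq_zero_iff.1 (hinv (blockSwap n))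
      simpa using measure_congr ((ae_eq_refl X).inter hae.symm)
    simp only [hconst] at hlim
    have hsq := tendsto_nhds_unique hlim tendsto_const_nhds
    rw [measureReal_def, ← hμ hX, ← measureReal_def] at hsq
    have hfac : μK.real X = 0 ∨ μK.real X = 1 := by
      rcases eq_or_ne (μK.real X) 0 with h | h
      · exact .inl h
      · exact .inr (mul_left_cancel₀ h (by rw [hsq, mul_one]))
    simpa [measureReal_def, ENNReal.toReal_eq_zero_iff, ENNReal.toReal_eq_one_iff] using hfac

end Ergo
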